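/- arXiv:2210.09239 — 7 statements merged into one kernel-verified Lean document; each statement's English description precedes it below -/
import Mathlib

section
/- Let L be a first-order language, M and N be L-structures, and α a type. Let u : α → M be a surjective map and w : α → N any map. If for every L-formula φ with free variables indexed by α one has φ.Realize u ↔ φ.Realize w, then there exists an elementary embedding f : M ↪ N (in the language L) such that f ∘ u = w. -/
open FirstOrder FirstOrder.Language

theorem stmt_0 {L : FirstOrder.Language} {M N : Type*} [L.Structure M] [L.Structure N]
    {α : Type*} (u : α → M) (w : α → N) (hu : Function.Surjective u)
    (h : ∀ φ : L.Formula α, φ.Realize u ↔ φ.Realize w) :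
    ∃ f : M ↪ₑ[L] N, ⇑f ∘ u = w := by
  obtain ⟨g, hg⟩ := hu.hasRightInverse
  refine ⟨⟨w ∘ g, fun n φ x => ?_⟩, funext fun a => ?_⟩
  · have key := h (φ.relabel (g ∘ x))
    rw [Formula.realize_relabel, Formula.realize_relabel, ← Function.comp_assoc,
      ← Function.comp_assoc, hg.comp_eq_id, Function.id_comp] at key
    exact key.symm
  · have key := h ((Term.var (g (u a))).equal (Term.var a))
    rw [Formula.realize_equal, Formula.realize_equal] at key
    exact key.1 (hg (u a))
end

section
/- Let L be a first-order language, M and N be L-structures, and α a type. Let u : α → M and w : α → N both be surjective maps. If for every L-formula φ with free variables indexed by α one has φ.Realize u ↔ φ.Realize w, then there exists an L-isomorphism f : M ≃ N such that f ∘ u = w. -/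
open FirstOrder FirstOrder.Language

theorem stmt_1 {L : FirstOrder.Language} {M N : Type*} [L.Structure M] [L.Structure N]
    {α : Type*} (u : α → M) (w : α → N)
    (hu : Function.Surjective u) (hw : Function.Surjective w)
    (h : ∀ φ : L.Formula α, φ.Realize u ↔ φ.Realize w) :
    ∃ f : M ≃[L] N, ⇑f ∘ u = w := by
  have heq (s t : L.Term α) : s.realize u = t.realize u ↔ s.realize w = t.realize w := by
    simpa only [Formula.realize_equal] using h (s.equal t)
  have hvar (a b : α) : u a = u b ↔ w a = w b := heq (Term.var a) (Term.var b)
  obtain ⟨g, hg⟩ : ∃ g : M → N, ∀ a, g (u a) = w a :=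
    ⟨fun m => w (Function.surjInv hu m),
      fun a => (hvar _ _).1 (Function.surjInv_eq hu (u a))⟩
  have hbij : Function.Bijective g := by
    refine ⟨fun x y hxy => ?_, fun n => ?_⟩
    · obtain ⟨a, rfl⟩ := hu x
      obtain ⟨b, rfl⟩ := hu y
      rw [hg, hg] at hxy
      exact (hvar a b).2 hxy
    · obtain ⟨a, rfl⟩ := hw n
      exact ⟨u a, hg a⟩
  have hcomp {n : ℕ} (c : Fin n → α) : g ∘ u ∘ c = w ∘ c := funext fun i => hg (c i)
  refine ⟨⟨Equiv.ofBijective g hbij, fun {n} f x => ?_, fun {n} r x => ?_⟩, funext hg⟩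
  · obtain ⟨c, rfl⟩ := hu.comp_left x
    obtain ⟨a, ha⟩ := hu (Structure.funMap f (u ∘ c))
    change g (Structure.funMap f (u ∘ c)) = Structure.funMap f (g ∘ u ∘ c)
    rw [hcomp, ← ha, hg]
    exact (heq (Term.var a) (Term.func f fun i => Term.var (c i))).1 ha
  · obtain ⟨c, rfl⟩ := hu.comp_left x
    change Structure.RelMap r (g ∘ u ∘ c) ↔ Structure.RelMap r (u ∘ c)
    rw [hcomp]
    have hr := h (r.formula fun i => Term.var (c i))
    rw [Formula.realize_rel, Formula.realize_rel] at hr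
    exact hr.symm
end

section
/- Let L be a first-order language, M and N be L-structures, and α a type. Let u : α → M and w : α → N both be surjective maps. Then there exists an elementary embedding from M into N if and only if there exists a map ρ : α → α such that for every L-formula φ with free variables indexed by α, φ.Realize u ↔ φ.Realize (w ∘ ρ). -/
open FirstOrder FirstOrder.Language

theorem stmt_3 {L : FirstOrder.Language} {M N : Type*} [L.Structure M] [L.Structure N]
    {α : Type*} (u : α → M) (w : α → N)
    (hu : Function.Surjective u) (hw : Function.Surjective w) :
    Nonempty (M ↪ₑ[L] N) ↔
      ∃ ρ : α → α, ∀ φ : L.Formula α, φ.Realize u ↔ φ.Realize (w ∘ ρ) := by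
  constructor
  · rintro ⟨f⟩
    refine ⟨fun a => Function.surjInv hw (f (u a)), fun φ => ?_⟩
    rw [← f.map_formula φ u]
    have h : (w ∘ fun a => Function.surjInv hw (f (u a))) = f ∘ u :=
      funext fun a => Function.surjInv_eq hw (f (u a))
    rw [h]
  · rintro ⟨ρ, hρ⟩
    refine ⟨⟨fun m => w (ρ (Function.surjInv hu m)), fun n φ x => ?_⟩⟩
    have h := hρ (φ.relabel (Function.surjInv hu ∘ x))
    have hx : u ∘ Function.surjInv hu ∘ x = x :=
      funext fun i => Function.surjInv_eq hu (x i)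
    rw [Formula.realize_relabel, Formula.realize_relabel, hx] at h
    exact h.symm
end

section
/- Let L be a first-order language, M and N be L-structures, and α a type. Let u : α → M and w : α → N both be surjective maps. Then M and N are isomorphic as L-structures if and only if there exists a map ρ : α → α such that (i) for every L-formula φ with free variables indexed by α, φ.Realize u ↔ φ.Realize (w ∘ ρ), and (ii) for every i : α there exists i' in the range of ρ with w i = w i'. -/
open FirstOrder FirstOrder.Language

/-- Two structures enumerated by the same index type are isomorphic as soon as the enumerations
satisfy the same formulas. -/
theorem FirstOrder.Language.nonempty_equiv_of_realize_iff {L : FirstOrder.Language} {M N : Type*}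
    [L.Structure M] [L.Structure N] {α : Type*} {u : α → M} {v : α → N}
    (hu : Function.Surjective u) (hv : Function.Surjective v)
    (h : ∀ φ : L.Formula α, φ.Realize u ↔ φ.Realize v) : Nonempty (M ≃[L] N) := by
  have term_eq (s t : L.Term α) : s.realize u = t.realize u ↔ s.realize v = t.realize v := by
    simpa using h (s.equal t)
  have var_eq (i j : α) : u i = u j ↔ v i = v j := term_eq (Term.var i) (Term.var j)
  let f : M → N := v ∘ Function.surjInv hu
  have hf (i : α) : f (u i) = v i := (var_eq _ _).1 (Function.surjInv_eq hu (u i))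
  have hf_bij : Function.Bijective f := by
    refine ⟨fun a b hab => ?_, fun b => ?_⟩
    · obtain ⟨i, rfl⟩ := hu a
      obtain ⟨j, rfl⟩ := hu b
      rwa [hf, hf, ← var_eq] at hab
    · obtain ⟨i, rfl⟩ := hv b
      exact ⟨u i, hf i⟩
  refine ⟨⟨Equiv.ofBijective f hf_bij, fun {n} F x => ?_, fun {n} R x => ?_⟩⟩
  · obtain ⟨k, rfl⟩ := hu.comp_left x
    obtain ⟨j, hj⟩ := hu (Structure.funMap F (u ∘ k))
    have hv_j : v j = Structure.funMap F (v ∘ k) :=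
      (term_eq (Term.var j) (Term.func F fun i => Term.var (k i))).1 hj
    change f (Structure.funMap F (u ∘ k)) = Structure.funMap F (f ∘ u ∘ k)
    rw [← hj, hf, hv_j, ← Function.comp_assoc, show f ∘ u = v from funext hf]
  · obtain ⟨k, rfl⟩ := hu.comp_left x
    change Structure.RelMap R (f ∘ u ∘ k) ↔ Structure.RelMap R (u ∘ k)
    rw [← Function.comp_assoc, show f ∘ u = v from funext hf]
    have hR := h (R.formula fun i => Term.var (k i))
    rw [Formula.realize_rel, Formula.realize_rel] at hR
    exact hR.symm

theorem stmt_4 {L : FirstOrder.Language} {M N : Type*} [L.Structure M] [L.Structure N]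
    {α : Type*} (u : α → M) (w : α → N)
    (hu : Function.Surjective u) (hw : Function.Surjective w) :
    Nonempty (M ≃[L] N) ↔
      ∃ ρ : α → α,
        (∀ φ : L.Formula α, φ.Realize u ↔ φ.Realize (w ∘ ρ)) ∧
        (∀ i : α, ∃ i' ∈ Set.range ρ, w i = w i') := by
  constructor
  · rintro ⟨e⟩
    obtain ⟨ρ, hρ⟩ := hw.comp_left (e ∘ u)
    refine ⟨ρ, fun φ => ?_, fun i => ?_⟩
    · rw [show w ∘ ρ = e ∘ u from hρ]
      exact (StrongHomClass.realize_formula e φ).symm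
    · obtain ⟨j, hj⟩ := hu (e.symm (w i))
      refine ⟨ρ j, ⟨j, rfl⟩, ?_⟩
      rw [show w (ρ j) = e (u j) from congrFun hρ j, hj, e.apply_symm_apply]
  · rintro ⟨ρ, h, hρ⟩
    refine nonempty_equiv_of_realize_iff hu (fun b => ?_) h
    obtain ⟨i, rfl⟩ := hw b
    obtain ⟨_, ⟨j, rfl⟩, hj⟩ := hρ i
    exact ⟨j, hj.symm⟩
end

section
/- Let L be a first-order language, M and N be L-structures, and α a type. Suppose M and N are nonempty and the cardinalities of M and of N are both at most the cardinality of α. Then there exists an elementary embedding from M into N if and only if there exist surjective maps u : α → M and w : α → N and a map ρ : α → α such that for every L-formula φ with free variables indexed by α, φ.Realize u ↔ φ.Realize (w ∘ ρ). -/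
open FirstOrder FirstOrder.Language Cardinal

universe u v

theorem exists_surjective_of_lift_mk_le {M : Type u} {α : Type v} [Nonempty M]
    (h : Cardinal.lift.{v} #M ≤ Cardinal.lift.{u} #α) :
    ∃ g : α → M, Function.Surjective g :=
  let ⟨e⟩ := Cardinal.lift_mk_le'.1 h
  ⟨Function.invFun e, Function.invFun_surjective e.injective⟩

theorem stmt_6 {L : FirstOrder.Language} {M : Type u} {N : Type u} [L.Structure M] [L.Structure N]
    {α : Type v} [Nonempty M] [Nonempty N]
    (hM : Cardinal.lift.{v} #M ≤ Cardinal.lift.{u} #α)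
    (hN : Cardinal.lift.{v} #N ≤ Cardinal.lift.{u} #α) :
    Nonempty (M ↪ₑ[L] N) ↔
      ∃ (u' : α → M) (w : α → N) (ρ : α → α),
        Function.Surjective u' ∧ Function.Surjective w ∧
        ∀ φ : L.Formula α, φ.Realize u' ↔ φ.Realize (w ∘ ρ) := by
  constructor
  · rintro ⟨f⟩
    obtain ⟨p, hp⟩ := exists_surjective_of_lift_mk_le hM
    obtain ⟨w, hw⟩ := exists_surjective_of_lift_mk_le hN
    refine ⟨p, w, Function.surjInv hw ∘ f ∘ p, hp, hw, fun φ => ?_⟩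
    rw [← Function.comp_assoc, (Function.rightInverse_surjInv hw).comp_eq_id,
      Function.id_comp, f.map_formula]
  · rintro ⟨p, w, ρ, hp, -, h⟩
    refine ⟨⟨w ∘ ρ ∘ Function.surjInv hp, fun n φ x => ?_⟩⟩
    have hφ := h (φ.relabel (Function.surjInv hp ∘ x))
    rw [Formula.realize_relabel, Formula.realize_relabel, ← Function.comp_assoc,
      (Function.rightInverse_surjInv hp).comp_eq_id, Function.id_comp] at hφ
    exact hφ.symm
end

section
/- Let L be a first-order language, T an L-theory, α a type, and p a complete type of T over α. Then p has the Henkin property if and only if there exist a model M of T and a surjective map v : α → M such that typeOf v = p. In particular, every complete type of T over α with the Henkin property is realized in a model of T whose cardinality is at most the cardinality of α. -/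
open FirstOrder Cardinal

universe u v w

/-- A complete type `p` of `T` over `α` has the Henkin property if, for every `L(α)`-formula
`φ` with one free variable, whenever the sentence `∃ x, φ x` belongs to `p`, there is some
`a : α` such that the sentence `φ (c_a)` belongs to `p`. -/
def FirstOrder.Language.Theory.CompleteType.HasHenkin {L : FirstOrder.Language.{u, v}}
    {T : L.Theory} {α : Type w} (p : T.CompleteType α) : Prop :=
  ∀ φ : L[[α]].Formula Unit,
    (Language.BoundedFormula.relabel (fun _ => Sum.inr 0) φ).ex ∈ p →
      ∃ a : α, φ.subst (fun _ => (L.con a).term) ∈ p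

namespace FirstOrder.Language

variable {L : Language.{u, v}}

/-- The sentence `∃ x, φ x` holds exactly when `φ` is satisfied by some element. -/
theorem Formula.realize_relabel_ex {M : Type*} [L.Structure M] (φ : L.Formula Unit) :
    Sentence.Realize M
        (BoundedFormula.relabel (fun _ => Sum.inr 0 : Unit → Empty ⊕ Fin 1) φ).ex ↔
      ∃ x : M, φ.Realize fun _ => x := by
  rw [Sentence.Realize, Formula.Realize, BoundedFormula.realize_ex]
  refine exists_congr fun x => ?_
  rw [BoundedFormula.realize_relabel, Formula.Realize]
  refine iff_of_eq ?_
  congr 1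
  exact Subsingleton.elim _ _

/-- Substituting a constant symbol for the free variable evaluates the formula at the constant. -/
theorem Formula.realize_subst_constant {M : Type*} [L.Structure M] (φ : L.Formula Unit)
    (c : L.Constants) :
    Sentence.Realize M (φ.subst (fun _ => c.term) : L.Formula Empty) ↔
      φ.Realize fun _ => (c : M) := by
  rw [Sentence.Realize, Formula.Realize, BoundedFormula.realize_subst]
  simp only [Term.realize_constants]
  rfl

/-- If every satisfiable formula in one variable is satisfied by the value of one of the
constants `c i`, then the set of these values meets all nonempty definable sets. -/
theorem meetsDefinable_range_constants {M : Type*} [L.Structure M] {ι : Type*}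
    (c : ι → L.Constants)
    (h : ∀ φ : L.Formula Unit, (∃ x : M, φ.Realize fun _ => x) →
      ∃ i, φ.Realize fun _ => (c i : M)) :
    L.MeetsDefinable (Set.range fun i => (c i : M)) := by
  rintro D ⟨x, hx⟩ ⟨φ, hφ⟩
  let ψ : L.Formula Unit := (BoundedFormula.constantsVarsEquiv φ).subst
    (Sum.elim (fun a => (c a.2.choose).term) fun _ => Term.var ())
  have hψ (y : M) : ψ.Realize (fun _ => y) ↔ y ∈ D := by
    have hy : y ∈ D ↔ φ.Realize fun _ => y := Set.ext_iff.1 hφ fun _ => y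
    rw [hy, Formula.Realize, BoundedFormula.realize_subst, Formula.Realize,
      ← BoundedFormula.realize_constantsVarsEquiv]
    refine iff_of_eq ?_
    congr 1
    ext (a | _)
    · simpa using a.2.choose_spec
    · rfl
  obtain ⟨i, hi⟩ := h ψ ⟨x, (hψ x).2 hx⟩
  exact ⟨_, (hψ _).1 hi, i, rfl⟩

namespace Theory.CompleteType

variable {T : L.Theory} {α : Type w}

theorem mem_iff_realize (p : T.CompleteType α)
    (N : ModelType (p : L[[α]].Theory)) (φ : L[[α]].Sentence) : φ ∈ p ↔ Sentence.Realize N φ :=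
  (p.isMaximal.mem_iff_models φ).trans (p.isMaximal.isComplete.realize_sentence_iff φ N).symm

/-- A model of a complete type, seen as a model of the base theory. -/
abbrev reductModel (p : T.CompleteType α) (N : ModelType (p : L[[α]].Theory)) : T.ModelType :=
  (N.subtheoryModel p.subset).reduct (L.lhomWithConstants α)

/-- The values of the new constants in a model of a complete type. -/
def constantValues (p : T.CompleteType α) (N : ModelType (p : L[[α]].Theory)) :
    α → p.reductModel N :=
  fun a => ((L.con a : L[[α]].Constants) : N)

theorem typeOf_constantValues (p : T.CompleteType α) (N : ModelType (p : L[[α]].Theory)) :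
    T.typeOf (p.constantValues N) = p := by
  refine SetLike.ext fun φ => ?_
  refine mem_typeOf.trans (_root_.Iff.trans ?_ (p.mem_iff_realize N φ).symm)
  let : L[[α]].Structure (p.reductModel N) := N.struc
  have : (L.lhomWithConstants α).IsExpansionOn (p.reductModel N) :=
    ⟨fun _ _ => rfl, fun _ _ => rfl⟩
  exact Formula.realize_equivSentence_symm_con (p.reductModel N) φ

theorem mem_typeOf_iff_realize {M : Type*} [L.Structure M] [Nonempty M] [M ⊨ T] (v : α → M)
    (φ : L[[α]].Sentence) :
    letI := constantsOn.structure v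
    φ ∈ T.typeOf v ↔ Sentence.Realize M φ :=
  Iff.rfl

theorem hasHenkin_typeOf {M : Type*} [L.Structure M] [Nonempty M] [M ⊨ T] {v : α → M}
    (hv : Function.Surjective v) : (T.typeOf v).HasHenkin := by
  let := constantsOn.structure v
  intro φ hφ
  rw [mem_typeOf_iff_realize, Formula.realize_relabel_ex] at hφ
  obtain ⟨x, hx⟩ := hφ
  obtain ⟨a, rfl⟩ := hv x
  refine ⟨a, ?_⟩
  rw [mem_typeOf_iff_realize, Formula.realize_subst_constant]
  have ha : ((L.con a : L[[α]].Constants) : M) = v a := rfl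
  rwa [ha]

/-- A complete type with the Henkin property has a model all of whose elements are values of
constants. -/
theorem HasHenkin.exists_model {p : T.CompleteType α} (hp : p.HasHenkin) :
    ∃ N : ModelType.{max u w, v, w} (p : L[[α]].Theory),
      Function.Surjective fun a => ((L.con a : L[[α]].Constants) : N) := by
  obtain ⟨M⟩ := p.isMaximal.1
  have hA : L[[α]].MeetsDefinable (Set.range fun a => ((L.con a : L[[α]].Constants) : M)) := by
    refine meetsDefinable_range_constants _ fun φ hφ => ?_
    obtain ⟨a, ha⟩ := hp φ ((p.mem_iff_realize M _).2 ((Formula.realize_relabel_ex φ).2 hφ))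
    exact ⟨a, (Formula.realize_subst_constant φ _).1 ((p.mem_iff_realize M _).1 ha)⟩
  let S := hA.toElementarySubstructure
  have hS : Function.Surjective fun a => ((L.con a : L[[α]].Constants) : S) := by
    rintro ⟨x, hx⟩
    obtain ⟨a, rfl⟩ := hA.closure_eq_self.subset hx
    exact ⟨a, Subtype.ext (S.subtype.map_constants _)⟩
  have : Small.{w} S := small_of_surjective hS
  refine ⟨(S.toModel (p : L[[α]].Theory)).shrink, fun y => ?_⟩
  let e : S ≃ Shrink.{w} S := equivShrink S
  let := e.inducedStructure (L := L[[α]])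
  obtain ⟨a, ha⟩ := hS (e.symm y)
  refine ⟨a, ?_⟩
  refine (HomClass.map_constants (e.inducedStructureEquiv (L := L[[α]])) (L.con a)).symm.trans ?_
  exact (congrArg e ha).trans (e.apply_symm_apply y)

theorem HasHenkin.exists_surjective {p : T.CompleteType α} (hp : p.HasHenkin) :
    ∃ (M : ModelType.{u, v, w} T) (v : α → M), Function.Surjective v ∧ T.typeOf v = p := by
  obtain ⟨N, hN⟩ := hp.exists_model
  exact ⟨p.reductModel N, p.constantValues N, hN, p.typeOf_constantValues N⟩

end Theory.CompleteType

end FirstOrder.Language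

theorem stmt_7 {L : FirstOrder.Language.{u, v}} (T : L.Theory) (α : Type w)
    (p : T.CompleteType α) :
    (p.HasHenkin ↔
      ∃ (M : Language.Theory.ModelType.{u, v, w} T) (v : α → M),
        Function.Surjective v ∧ T.typeOf v = p) ∧
    (p.HasHenkin →
      ∃ (M : Language.Theory.ModelType.{u, v, w} T) (v : α → M),
        T.typeOf v = p ∧ #M ≤ #α) := by
  refine ⟨⟨fun hp => hp.exists_surjective, ?_⟩, fun hp => ?_⟩
  · rintro ⟨M, v, hv, rfl⟩
    exact Language.Theory.CompleteType.hasHenkin_typeOf hv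
  · obtain ⟨M, v, hv, hp⟩ := hp.exists_surjective
    exact ⟨M, v, hp, mk_le_of_surjective hv⟩
end

section
/- Let L be a first-order language, T an L-theory, M a model of T, α a type, and a : α → M a surjective map. For a complete type q of T over α, the following are equivalent: (1) there exists a surjective map b : α → M with typeOf b = q; (2) there exists a map ρ : α → α such that (i) for every L-formula φ with free variables indexed by α, φ belongs to q (under the canonical correspondence between L-formulas over α and L(α)-sentences) if and only if φ.Realize (a ∘ ρ), and (ii) for every i : α there exists i' in the range of ρ with a i = a i'. -/
open FirstOrder Cardinal

universe u v w

theorem stmt_8 {L : FirstOrder.Language.{u, v}} (T : L.Theory)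
    {M : Type w} [L.Structure M] [Nonempty M] [M ⊨ T]
    {α : Type*} (a : α → M) (ha : Function.Surjective a)
    (q : T.CompleteType α) :
    (∃ b : α → M, Function.Surjective b ∧ T.typeOf b = q) ↔
      ∃ ρ : α → α,
        (∀ φ : L.Formula α,
          Language.Formula.equivSentence φ ∈ q ↔ φ.Realize (a ∘ ρ)) ∧
        (∀ i : α, ∃ i' ∈ Set.range ρ, a i = a i') := by
  constructor
  · rintro ⟨b, hb, rfl⟩
    obtain ⟨ρ, rfl⟩ := ha.comp_left b
    refine ⟨ρ, fun φ => Language.Theory.CompleteType.formula_mem_typeOf, fun i => ?_⟩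
    obtain ⟨j, hj⟩ := hb (a i)
    exact ⟨ρ j, ⟨j, rfl⟩, hj.symm⟩
  · rintro ⟨ρ, hρ, hrange⟩
    refine ⟨a ∘ ρ, fun m => ?_, SetLike.ext fun ψ => ?_⟩
    · obtain ⟨i, rfl⟩ := ha m
      obtain ⟨_, ⟨j, rfl⟩, hj⟩ := hrange i
      exact ⟨j, hj.symm⟩
    · obtain ⟨φ, rfl⟩ := Language.Formula.equivSentence.surjective ψ
      exact Language.Theory.CompleteType.formula_mem_typeOf.trans (hρ φ).symm
end
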